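/- Generic semisimplicity: if c_ξ − c_τ ∉ ℤ∖{0} for all ξ, τ ∈ Irr(W), then the category O_c(W) is semisimple. -/

import Mathlib

/-! Core definitions: complex reflection groups, rational Cherednik algebras,
and their categories 𝒪. -/

noncomputable section

open Module Function

/-- A (complex) reflection: a linear automorphism `g` with `rank (g - 1) = 1`. -/
def IsComplexReflection {V : Type} [AddCommGroup V] [Module ℂ V]
    (g : V ≃ₗ[ℂ] V) : Prop :=
  Module.finrank ℂ (LinearMap.range (g.toLinearMap - LinearMap.id)) = 1

variable (V : Type) [AddCommGroup V] [Module ℂ V] [FiniteDimensional ℂ V]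

/-- A finite complex reflection group on a finite dimensional complex vector
space `V`: a finite subgroup of `GL(V)` generated by its reflections. -/
structure CRG where
  W : Subgroup (V ≃ₗ[ℂ] V)
  finite : Finite W
  gen : Subgroup.closure {g : V ≃ₗ[ℂ] V | g ∈ W ∧ IsComplexReflection g} = W

variable {V}

/-- The set `S` of reflections in `W`. -/
def CRG.Refl (G : CRG V) : Type :=
  {s : G.W // IsComplexReflection (s : V ≃ₗ[ℂ] V)}

instance (G : CRG V) : CoeOut G.Refl G.W := ⟨fun s => s.1⟩

/-- Conjugation invariance of a parameter `c : S → ℂ`. -/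
def IsConjInvariant {G : CRG V} (c : G.Refl → ℂ) : Prop :=
  ∀ s t : G.Refl, (∃ g : G.W, t.1 = g * s.1 * g⁻¹) → c t = c s

/-- For each reflection `s`: eigenvectors `α_s ∈ h*`, `α_s^∨ ∈ h` for `s` with
eigenvalue different from `1`, normalized by `⟨α_s, α_s^∨⟩ = 2`; `lam s` is the
eigenvalue of `s` on `h*` different from `1`. -/
structure ReflData (G : CRG V) where
  α : G.Refl → Module.Dual ℂ V
  αv : G.Refl → V
  lam : G.Refl → ℂ
  lam_ne_one : ∀ s, lam s ≠ 1
  α_ne : ∀ s, α s ≠ 0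
  αv_ne : ∀ s, αv s ≠ 0
  eig_α : ∀ (s : G.Refl) (v : V),
    α s (((s.1 : V ≃ₗ[ℂ] V)).symm v) = lam s * α s v
  eig_αv : ∀ s : G.Refl, ∃ μ : ℂ, μ ≠ 1 ∧ ((s.1 : V ≃ₗ[ℂ] V)) (αv s) = μ • αv s
  pairing : ∀ s, α s (αv s) = 2

/-- The rational Cherednik algebra `H_c(W)`: the quotient of `T(h ⊕ h*)#W` by
the commutation relations, presented via its universal property. -/
structure RCA (G : CRG V) (D : ReflData G) (c : G.Refl → ℂ) where
  H : Type
  [ring : Ring H]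
  [alg : Algebra ℂ H]
  x : Module.Dual ℂ V →ₗ[ℂ] H
  y : V →ₗ[ℂ] H
  w : G.W →* H
  comm_x : ∀ a b, x a * x b = x b * x a
  comm_y : ∀ u v, y u * y v = y v * y u
  w_x : ∀ (g : G.W) (a : Module.Dual ℂ V),
    w g * x a = x (a ∘ₗ (((g⁻¹ : G.W) : V ≃ₗ[ℂ] V) : V →ₗ[ℂ] V)) * w g
  w_y : ∀ (g : G.W) (v : V), w g * y v = y (((g : V ≃ₗ[ℂ] V)) v) * w g
  rel : ∀ (v : V) (a : Module.Dual ℂ V),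
    y v * x a - x a * y v =
      algebraMap ℂ H (a v) -
        ∑ᶠ s : G.Refl, (c s * D.α s v * a (D.αv s)) • w s.1
  universal : ∀ (A : Type) [Ring A] [Algebra ℂ A]
      (xA : Module.Dual ℂ V →ₗ[ℂ] A) (yA : V →ₗ[ℂ] A) (wA : G.W →* A),
      (∀ a b, xA a * xA b = xA b * xA a) →
      (∀ u v, yA u * yA v = yA v * yA u) →
      (∀ (g : G.W) (a : Module.Dual ℂ V),
        wA g * xA a = xA (a ∘ₗ (((g⁻¹ : G.W) : V ≃ₗ[ℂ] V) : V →ₗ[ℂ] V)) * wA g) →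
      (∀ (g : G.W) (v : V), wA g * yA v = yA (((g : V ≃ₗ[ℂ] V)) v) * wA g) →
      (∀ (v : V) (a : Module.Dual ℂ V),
        yA v * xA a - xA a * yA v =
          algebraMap ℂ A (a v) -
            ∑ᶠ s : G.Refl, (c s * D.α s v * a (D.αv s)) • wA s.1) →
      ∃! φ : H →ₐ[ℂ] A,
        (∀ a, φ (x a) = xA a) ∧ (∀ v, φ (y v) = yA v) ∧ (∀ g, φ (w g) = wA g)

attribute [instance] RCA.ring RCA.alg

variable {G : CRG V} {D : ReflData G} {c : G.Refl → ℂ}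

/-- The category `𝒪_c(W)`: modules over `H_c` which are finitely generated and
on which `h` acts locally nilpotently. -/
structure CatO (R : RCA G D c) where
  M : Type
  [ab : AddCommGroup M]
  [mod : Module R.H M]
  locNilp : ∀ m : M, ∃ N : ℕ, ∀ L : List V, L.length = N →
    (L.map fun v => R.y v).prod • m = 0
  fg : Module.Finite R.H M

attribute [instance] CatO.ab CatO.mod

instance catO (R : RCA G D c) : CategoryTheory.Category (CatO R) where
  Hom A B := A.M →ₗ[R.H] B.M
  id A := LinearMap.id
  comp f g := g.comp f
  id_comp f := LinearMap.comp_id f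
  comp_id f := LinearMap.id_comp f
  assoc f g h := (LinearMap.comp_assoc _ _ _).symm

/-- A finite dimensional representation of `W`. -/
structure WRep (G : CRG V) where
  T : Type
  [ab : AddCommGroup T]
  [mod : Module ℂ T]
  [fd : FiniteDimensional ℂ T]
  ρ : G.W →* (T ≃ₗ[ℂ] T)

attribute [instance] WRep.ab WRep.mod WRep.fd

/-- Irreducibility of a representation of `W`. -/
def WRep.IsIrr {G : CRG V} (τ : WRep G) : Prop :=
  Nontrivial τ.T ∧ ∀ U : Submodule ℂ τ.T,
    (∀ (g : G.W) (t : τ.T), t ∈ U → τ.ρ g t ∈ U) → U = ⊥ ∨ U = ⊤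

/-- Isomorphism of representations of `W`. -/
def WRep.Iso {G : CRG V} (τ τ' : WRep G) : Prop :=
  ∃ e : τ.T ≃ₗ[ℂ] τ'.T, ∀ (g : G.W) (t : τ.T), e (τ.ρ g t) = τ'.ρ g (e t)

/-- `M`, together with the lowest weight inclusion `ι : τ → M`, is the Verma
module `Δ_c(τ) = H_c ⊗_{S(h)#W} τ`, presented via its universal property. -/
structure VermaStr (R : RCA G D c) (τ : WRep G) (M : Type) [AddCommGroup M]
    [Module R.H M] where
  ι : τ.T →+ M
  ι_smul : ∀ (a : ℂ) (t : τ.T), ι (a • t) = algebraMap ℂ R.H a • ι t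
  ι_y : ∀ (v : V) (t : τ.T), R.y v • ι t = 0
  ι_w : ∀ (g : G.W) (t : τ.T), R.w g • ι t = ι (τ.ρ g t)
  universal : ∀ (N : Type) [AddCommGroup N] [Module R.H N] (κ : τ.T →+ N),
      (∀ (a : ℂ) (t : τ.T), κ (a • t) = algebraMap ℂ R.H a • κ t) →
      (∀ (v : V) (t : τ.T), R.y v • κ t = 0) →
      (∀ (g : G.W) (t : τ.T), R.w g • κ t = κ (τ.ρ g t)) →
      ∃! φ : M →ₗ[R.H] N, ∀ t, φ (ι t) = κ t

/-- A greatest proper submodule (so the quotient is the unique simple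
quotient). -/
def IsGreatestProper {A : Type} [Ring A] {M : Type} [AddCommGroup M]
    [Module A M] (N : Submodule A M) : Prop :=
  N ≠ ⊤ ∧ ∀ N' : Submodule A M, N' ≠ ⊤ → N' ≤ N

end

section Stmt6
noncomputable section

variable {V : Type} [AddCommGroup V] [Module ℂ V] [FiniteDimensional ℂ V]
variable {G : CRG V} {D : ReflData G} {c : G.Refl → ℂ}

open Module

/-- The Euler element `h = Σ x_i y_i + n/2 − Σ_s (2c(s)/(1−λ_s)) s` of `H_c`. -/
def eulerElt (R : RCA G D c) {n : ℕ} (b : Basis (Fin n) ℂ V) : R.H :=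
  (∑ i, R.x (b.coord i) * R.y (b i)) + ((n : ℂ) / 2) • (1 : R.H)
    - ∑ᶠ s : G.Refl, (2 * c s / (1 - D.lam s)) • R.w s.1

set_option linter.unusedSectionVars false

instance (G : CRG V) : Finite G.W := G.finite

instance (G : CRG V) : Finite G.Refl := Subtype.finite

/-- The inverse of a reflection in terms of its root and coroot. -/
lemma ReflData.symm_apply (D : ReflData G) (s : G.Refl) (v : V) :
    (s.1 : V ≃ₗ[ℂ] V).symm v = v - ((1 - D.lam s) / 2 * D.α s v) • D.αv s := by
  obtain ⟨μ, hμ, hs⟩ := D.eig_αv s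
  set g : V ≃ₗ[ℂ] V := (s.1 : V ≃ₗ[ℂ] V)
  have hr : Module.finrank ℂ (LinearMap.range (g.toLinearMap - LinearMap.id)) = 1 := s.2
  have hμ' : μ - 1 ≠ 0 := sub_ne_zero.mpr hμ
  have hmem : D.αv s ∈ LinearMap.range (g.toLinearMap - LinearMap.id) := by
    refine ⟨(μ - 1)⁻¹ • D.αv s, ?_⟩
    simp only [LinearMap.sub_apply, LinearEquiv.coe_coe, LinearMap.id_apply, map_smul, hs]
    rw [inv_smul_eq_iff₀ hμ', sub_smul, one_smul]
  have hmem' : g.symm v - v ∈ LinearMap.range (g.toLinearMap - LinearMap.id) :=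
    ⟨-g.symm v, by simp [neg_add_eq_sub]⟩
  obtain ⟨r, hr'⟩ := (finrank_eq_one_iff_of_nonzero' (⟨D.αv s, hmem⟩ :
    LinearMap.range (g.toLinearMap - LinearMap.id))
    (fun h => D.αv_ne s (congrArg Subtype.val h))).mp hr ⟨_, hmem'⟩
  have h1 : r • D.αv s = g.symm v - v := congrArg Subtype.val hr'
  have h2 := congrArg (D.α s) h1
  rw [map_smul, map_sub, D.eig_α, D.pairing, smul_eq_mul] at h2
  have h3 : r = -((1 - D.lam s) / 2 * D.α s v) := by linear_combination h2 / 2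
  rw [sub_eq_add_neg, ← neg_smul, ← h3, h1]
  abel

namespace RCA

variable (R : RCA G D c)

lemma w_mul_x (s : G.Refl) (a : Module.Dual ℂ V) :
    R.w s.1 * R.x a = R.x a * R.w s.1 -
      ((1 - D.lam s) / 2 * a (D.αv s)) • (R.x (D.α s) * R.w s.1) := by
  have : a ∘ₗ (((s.1⁻¹ : G.W) : V ≃ₗ[ℂ] V) : V →ₗ[ℂ] V) =
      a - ((1 - D.lam s) / 2 * a (D.αv s)) • D.α s := by
    ext v
    have h := D.symm_apply s v
    have h' : ((s.1⁻¹ : G.W) : V ≃ₗ[ℂ] V) v = (s.1 : V ≃ₗ[ℂ] V).symm v := rfl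
    simp only [LinearMap.comp_apply, LinearEquiv.coe_coe, h', h, map_sub, map_smul,
      LinearMap.sub_apply, LinearMap.smul_apply, smul_eq_mul]
    ring
  rw [R.w_x, this, map_sub, map_smul, sub_mul, smul_mul_assoc]

lemma y_mul_w (s : G.Refl) (v : V) :
    R.y v * R.w s.1 = R.w s.1 * R.y v -
      ((1 - D.lam s) / 2 * D.α s v) • (R.w s.1 * R.y (D.αv s)) := by
  have h := R.w_y s.1 ((s.1 : V ≃ₗ[ℂ] V).symm v)
  rw [LinearEquiv.apply_symm_apply] at h
  rw [← h, D.symm_apply, map_sub, map_smul, mul_sub, mul_smul_comm]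

lemma y_mul_x (v : V) (a : Module.Dual ℂ V) [Fintype G.Refl] :
    R.y v * R.x a = R.x a * R.y v + (a v) • (1 : R.H) -
      ∑ s : G.Refl, (c s * D.α s v * a (D.αv s)) • R.w s.1 := by
  have := R.rel v a
  rw [finsum_eq_sum_of_fintype, Algebra.algebraMap_eq_smul_one] at this
  rw [sub_eq_iff_eq_add'.mp this, add_sub_assoc]

variable {n : ℕ} (b : Basis (Fin n) ℂ V)

lemma sum_smul_x (a : Module.Dual ℂ V) : ∑ i, a (b i) • R.x (b.coord i) = R.x a := by
  simp only [← map_smul, ← map_sum]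
  congr 1
  refine b.ext fun j => ?_
  simp

lemma sum_smul_y (v : V) : ∑ i, b.coord i v • R.y (b i) = R.y v := by
  simp only [← map_smul, ← map_sum]
  congr 1
  exact b.sum_repr v

lemma eulerElt_mul_x (a : Module.Dual ℂ V) :
    eulerElt R b * R.x a = R.x a * eulerElt R b + R.x a := by
  classical
  have := Fintype.ofFinite G.Refl
  simp only [eulerElt, finsum_eq_sum_of_fintype]
  have h1 : (∑ i, R.x (b.coord i) * R.y (b i)) * R.x a =
      R.x a * (∑ i, R.x (b.coord i) * R.y (b i)) + R.x a -
        ∑ s : G.Refl, (c s * a (D.αv s)) • (R.x (D.α s) * R.w s.1) := by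
    have h2 : ∀ i, R.x (b.coord i) * R.y (b i) * R.x a =
        R.x a * (R.x (b.coord i) * R.y (b i)) + a (b i) • R.x (b.coord i) -
        ∑ s : G.Refl, (c s * a (D.αv s)) • ((D.α s (b i) • R.x (b.coord i)) * R.w s.1) := by
      intro i
      rw [mul_assoc, R.y_mul_x, mul_sub, mul_add, ← mul_assoc, R.comm_x, mul_assoc,
        mul_smul_comm, mul_one, Finset.mul_sum]
      congr 1
      refine Finset.sum_congr rfl fun s _ => ?_
      rw [mul_smul_comm, smul_mul_assoc, smul_smul]
      congr 1
      ring
    rw [Finset.sum_mul, Finset.sum_congr rfl fun i _ => h2 i, Finset.sum_sub_distrib,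
      Finset.sum_add_distrib, R.sum_smul_x, Finset.mul_sum, Finset.sum_comm]
    congr 1
    refine Finset.sum_congr rfl fun s _ => ?_
    rw [← Finset.smul_sum, ← Finset.sum_mul, R.sum_smul_x]
  have h3 : (∑ s : G.Refl, (2 * c s / (1 - D.lam s)) • R.w s.1) * R.x a =
      R.x a * (∑ s : G.Refl, (2 * c s / (1 - D.lam s)) • R.w s.1) -
        ∑ s : G.Refl, (c s * a (D.αv s)) • (R.x (D.α s) * R.w s.1) := by
    rw [Finset.sum_mul, Finset.mul_sum, ← Finset.sum_sub_distrib]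
    refine Finset.sum_congr rfl fun s _ => ?_
    have : (1 - D.lam s) ≠ 0 := sub_ne_zero.mpr (D.lam_ne_one s).symm
    rw [smul_mul_assoc, R.w_mul_x, smul_sub, mul_smul_comm, smul_smul]
    congr 2
    field_simp
  rw [sub_mul, add_mul, h1, h3, mul_sub, mul_add, smul_mul_assoc, mul_smul_comm, one_mul, mul_one]
  abel

lemma eulerElt_mul_y (v : V) :
    eulerElt R b * R.y v = R.y v * eulerElt R b - R.y v := by
  classical
  have := Fintype.ofFinite G.Refl
  simp only [eulerElt, finsum_eq_sum_of_fintype]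
  have h1 : R.y v * (∑ i, R.x (b.coord i) * R.y (b i)) =
      (∑ i, R.x (b.coord i) * R.y (b i)) * R.y v + R.y v -
        ∑ s : G.Refl, (c s * D.α s v) • (R.w s.1 * R.y (D.αv s)) := by
    have h2 : ∀ i, R.y v * (R.x (b.coord i) * R.y (b i)) =
        R.x (b.coord i) * R.y (b i) * R.y v + b.coord i v • R.y (b i) -
        ∑ s : G.Refl, (c s * D.α s v) •
          (R.w s.1 * (b.coord i (D.αv s) • R.y (b i))) := by
      intro i
      rw [← mul_assoc, R.y_mul_x, sub_mul, add_mul, mul_assoc, R.comm_y, ← mul_assoc,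
        smul_mul_assoc, one_mul, Finset.sum_mul]
      congr 1
      refine Finset.sum_congr rfl fun s _ => ?_
      rw [mul_smul_comm, smul_mul_assoc, smul_smul]
    rw [Finset.mul_sum, Finset.sum_congr rfl fun i _ => h2 i, Finset.sum_sub_distrib,
      Finset.sum_add_distrib, R.sum_smul_y, Finset.sum_mul, Finset.sum_comm]
    congr 1
    refine Finset.sum_congr rfl fun s _ => ?_
    rw [← Finset.smul_sum, ← Finset.mul_sum, R.sum_smul_y]
  have h3 : R.y v * (∑ s : G.Refl, (2 * c s / (1 - D.lam s)) • R.w s.1) =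
      (∑ s : G.Refl, (2 * c s / (1 - D.lam s)) • R.w s.1) * R.y v -
        ∑ s : G.Refl, (c s * D.α s v) • (R.w s.1 * R.y (D.αv s)) := by
    rw [Finset.sum_mul, Finset.mul_sum, ← Finset.sum_sub_distrib]
    refine Finset.sum_congr rfl fun s _ => ?_
    have : (1 - D.lam s) ≠ 0 := sub_ne_zero.mpr (D.lam_ne_one s).symm
    rw [mul_smul_comm, R.y_mul_w, smul_sub, smul_mul_assoc, smul_smul]
    congr 2
    field_simp
  rw [mul_sub, mul_add, h1, h3, sub_mul, add_mul, smul_mul_assoc, mul_smul_comm, one_mul, mul_one]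
  abel

/-- The rational Cherednik algebra is generated by the images of `x`, `y` and `w`. -/
lemma adjoin_eq_top :
    Algebra.adjoin ℂ (Set.range R.x ∪ Set.range R.y ∪ Set.range R.w) = ⊤ := by
  set B := Algebra.adjoin ℂ (Set.range R.x ∪ Set.range R.y ∪ Set.range R.w)
  have hx : ∀ a, R.x a ∈ B := fun a => Algebra.subset_adjoin (Or.inl (Or.inl ⟨a, rfl⟩))
  have hy : ∀ v, R.y v ∈ B := fun v => Algebra.subset_adjoin (Or.inl (Or.inr ⟨v, rfl⟩))
  have hw : ∀ g, R.w g ∈ B := fun g => Algebra.subset_adjoin (Or.inr ⟨g, rfl⟩)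
  obtain ⟨φ, ⟨hφx, hφy, hφw⟩, -⟩ := R.universal B
    (R.x.codRestrict (Subalgebra.toSubmodule B) hx)
    (R.y.codRestrict (Subalgebra.toSubmodule B) hy)
    (R.w.codRestrict B.toSubmonoid hw)
    (fun a b => Subtype.ext (R.comm_x a b))
    (fun u v => Subtype.ext (R.comm_y u v))
    (fun g a => Subtype.ext (R.w_x g a))
    (fun g v => Subtype.ext (R.w_y g v))
    (fun v a => Subtype.ext (by
      have := Fintype.ofFinite G.Refl
      have h := R.rel v a
      rw [finsum_eq_sum_of_fintype] at h ⊢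
      refine Eq.trans h (Eq.symm (Eq.trans (B.val.map_sub _ _) ?_))
      rw [map_sum]
      rfl))
  obtain ⟨ψ, -, hψ⟩ := R.universal R.H R.x R.y R.w R.comm_x R.comm_y R.w_x R.w_y R.rel
  have h : B.val.comp φ = AlgHom.id ℂ R.H :=
    (hψ _ ⟨fun a => congrArg Subtype.val (hφx a), fun v => congrArg Subtype.val (hφy v),
      fun g => congrArg Subtype.val (hφw g)⟩).trans
      (hψ _ ⟨fun a => rfl, fun v => rfl, fun g => rfl⟩).symm
  refine eq_top_iff.mpr fun r _ => ?_
  have h' : (φ r : R.H) = r := DFunLike.congr_fun h r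
  exact h' ▸ (φ r).2

end RCA

section Eigen

variable {M ι : Type*} [AddCommGroup M] [Module ℂ M] {T : Module.End ℂ M}
  {F : ι → Submodule ℂ M} {χ : ι → ℂ}

/-- An eigenvector lying in a sum of subspaces of eigenspaces already lies in the sum of those
with the right eigenvalue. -/
lemma mem_iSup_of_eigenvector (hF : ∀ i, F i ≤ T.eigenspace (χ i)) {μ : ℂ} {p : M}
    (hp : p ∈ ⨆ i, F i) (hT : T p = μ • p) : p ∈ ⨆ i, ⨆ _ : χ i = μ, F i := by
  rw [iSup_split F (fun i => χ i = μ)] at hp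
  obtain ⟨u, hu, v, hv, rfl⟩ := Submodule.mem_sup.mp hp
  have hu' : u ∈ T.eigenspace μ :=
    (iSup₂_le fun i hi => hi ▸ hF i : ⨆ i, ⨆ _ : χ i = μ, F i ≤ T.eigenspace μ) hu
  have hv' : v ∈ ⨆ ν, ⨆ _ : ν ≠ μ, T.eigenspace ν :=
    (iSup₂_le fun i hi => (hF i).trans
      (le_iSup₂ (f := fun ν (_ : ν ≠ μ) => T.eigenspace ν) (χ i) hi) :
      ⨆ i, ⨆ _ : χ i ≠ μ, F i ≤ ⨆ ν, ⨆ _ : ν ≠ μ, T.eigenspace ν) hv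
  have hv'' : v ∈ T.eigenspace μ := by
    have := (T.eigenspace μ).sub_mem (Module.End.mem_eigenspace_iff.mpr hT) hu'
    rwa [add_sub_cancel_left] at this
  have hv0 : v = 0 := Submodule.disjoint_def.mp (T.eigenspaces_iSupIndep μ) v hv'' hv'
  rwa [hv0, add_zero]

lemma exists_sub_mem_eigenspace (hF : ∀ i, F i ≤ T.eigenspace (χ i)) (μ : ℂ) {u : M}
    (hu : u ∈ ⨆ i, F i) :
    ∃ v ∈ ⨆ i, F i, (T v - μ • v) - u ∈ T.eigenspace μ := by
  induction hu using Submodule.iSup_induction' with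
  | mem i u hu =>
    have h := Module.End.mem_eigenspace_iff.mp (hF i hu)
    by_cases hi : χ i = μ
    · refine ⟨0, zero_mem _, ?_⟩
      simpa using (T.eigenspace μ).neg_mem (hi ▸ hF i hu)
    · refine ⟨(χ i - μ)⁻¹ • u, Submodule.smul_mem _ _ (Submodule.mem_iSup_of_mem i hu), ?_⟩
      have : T ((χ i - μ)⁻¹ • u) - μ • (χ i - μ)⁻¹ • u - u = 0 := by
        rw [map_smul, h, smul_comm μ, ← smul_sub, ← sub_smul,
          inv_smul_smul₀ (sub_ne_zero.mpr hi), sub_self]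
      rw [this]
      exact zero_mem _
  | zero => exact ⟨0, zero_mem _, by simp⟩
  | add u u' _ _ h h' =>
    obtain ⟨v, hv, hv'⟩ := h
    obtain ⟨w, hw, hw'⟩ := h'
    refine ⟨v + w, add_mem hv hw, ?_⟩
    convert add_mem hv' hw' using 1
    rw [map_add, smul_add]
    abel

lemma map_mem_iSup_of_le_eigenspace (hF : ∀ i, F i ≤ T.eigenspace (χ i)) {u : M}
    (hu : u ∈ ⨆ i, F i) : T u ∈ ⨆ i, F i := by
  induction hu using Submodule.iSup_induction' with
  | mem i u hu =>
    rw [Module.End.mem_eigenspace_iff.mp (hF i hu)]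
    exact Submodule.smul_mem _ _ (Submodule.mem_iSup_of_mem i hu)
  | zero => simp
  | add u u' _ _ h h' => rw [map_add]; exact add_mem h h'

lemma eq_zero_of_generalized_eigenvector (hF : ∀ i, F i ≤ T.eigenspace (χ i)) {μ : ℂ}
    (hμ : ∀ i, χ i ≠ μ) {u : M} (hu : u ∈ ⨆ i, F i)
    (h : T (T u - μ • u) = μ • (T u - μ • u)) : u = 0 := by
  have key : ∀ p ∈ ⨆ i, F i, T p = μ • p → p = 0 := fun p hp hT => by
    simpa [hμ] using mem_iSup_of_eigenvector hF hp hT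
  exact key u hu (sub_eq_zero.mp (key _ (sub_mem (map_mem_iSup_of_le_eigenspace hF hu)
    (Submodule.smul_mem _ _ hu)) h))

end Eigen

section Irreducible

/-- A nonzero invariant subspace that is minimal with this property. -/
structure IsIrredSub {Γ M : Type*} [Group Γ] [AddCommGroup M] [Module ℂ M]
    (ρ : Representation ℂ Γ M) (U : Submodule ℂ M) : Prop where
  ne_bot : U ≠ ⊥
  map_mem : ∀ g, ∀ u ∈ U, ρ g u ∈ U
  eq_of_le : ∀ U' ≤ U, U' ≠ ⊥ → (∀ g, ∀ u ∈ U', ρ g u ∈ U') → U' = U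

variable {Γ M : Type*} [Group Γ] [Finite Γ] [AddCommGroup M] [Module ℂ M]
  {ρ : Representation ℂ Γ M}

lemma IsIrredSub.finiteDimensional {U : Submodule ℂ M} (hU : IsIrredSub ρ U) :
    FiniteDimensional ℂ U := by
  obtain ⟨m, hm, hm0⟩ := Submodule.exists_mem_ne_zero_of_ne_bot hU.ne_bot
  have h : Submodule.span ℂ (Set.range fun g => ρ g m) = U := by
    refine hU.eq_of_le _ (Submodule.span_le.mpr ?_) ?_ fun g u hu => ?_
    · rintro _ ⟨g, rfl⟩
      exact hU.map_mem g m hm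
    · refine fun h => hm0 ((Submodule.eq_bot_iff _).mp h m (Submodule.subset_span ⟨1, by simp⟩))
    · induction hu using Submodule.span_induction with
      | mem u hu =>
        obtain ⟨g', rfl⟩ := hu
        exact Submodule.subset_span ⟨g * g', by simp⟩
      | zero => simp
      | add u u' _ _ h h' => rw [map_add]; exact add_mem h h'
      | smul a u _ h => rw [map_smul]; exact Submodule.smul_mem _ _ h
  rw [← h]
  exact FiniteDimensional.span_of_finite ℂ (Set.finite_range _)

/-- **Maschke's theorem**: an invariant subspace is the sum of its irreducible subspaces. -/
lemma le_sSup_isIrredSub {S : Submodule ℂ M} (hS : ∀ g, ∀ u ∈ S, ρ g u ∈ S) :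
    S ≤ sSup {U | U ≤ S ∧ IsIrredSub ρ U} := by
  set Q := sSup {U | U ≤ S ∧ IsIrredSub ρ U}
  have hQs : ∀ g, ∀ u ∈ Q, ρ g u ∈ Q := by
    intro g
    refine (sSup_le fun U hU u hu => ?_ : Q ≤ Q.comap (ρ g))
    exact (le_sSup hU : U ≤ Q) (hU.2.map_mem g u hu)
  let σ : Subrepresentation ρ := ⟨S, fun g u hu => hS g u hu⟩
  let q : Subrepresentation ρ := ⟨Q, fun g u hu => hQs g u hu⟩
  have : NeZero (Nat.card Γ : ℂ) := ⟨Nat.cast_ne_zero.mpr Nat.card_pos.ne'⟩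
  have h := IsSemisimpleModule.sSup_simples_le σ.asSubmodule
  have h' : σ.asSubmodule ≤ q.asSubmodule := by
    rw [← h]
    refine sSup_le fun N ⟨hN, hNσ⟩ => ?_
    have hat := isSimpleModule_iff_isAtom.mp hN
    have : (Subrepresentation.ofSubmodule' N).toSubmodule ≤ Q := by
      refine le_sSup ⟨hNσ, ⟨fun h0 => hat.1 ?_, fun g u hu =>
        (Subrepresentation.ofSubmodule' N).apply_mem_toSubmodule g hu, fun U' hle h0 hst => ?_⟩⟩
      · exact (Submodule.eq_bot_iff _).mpr fun u hu => (Submodule.eq_bot_iff _).mp h0 u hu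
      · let u' : Subrepresentation ρ := ⟨U', fun g u hu => hst g u hu⟩
        rcases hat.le_iff.mp (show u'.asSubmodule ≤ N from hle) with h1 | h1
        · exact absurd ((Submodule.eq_bot_iff U').mpr fun u hu =>
            (Submodule.eq_bot_iff _).mp h1 u hu) h0
        · ext u
          exact SetLike.ext_iff.mp h1 u
    exact this
  exact h'

end Irreducible

namespace RCA

variable (R : RCA G D c) {M : Type} [AddCommGroup M] [Module ℂ M] [Module R.H M]
  [IsScalarTower ℂ R.H M]

/-- A subspace stable under the generators of `H_c`, as a submodule. -/
def submoduleOfStable (P : Submodule ℂ M) (hx : ∀ a, ∀ m ∈ P, R.x a • m ∈ P)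
    (hy : ∀ v, ∀ m ∈ P, R.y v • m ∈ P) (hw : ∀ g, ∀ m ∈ P, R.w g • m ∈ P) :
    Submodule R.H M where
  __ := P.toAddSubmonoid
  smul_mem' r m hm := by
    change r • m ∈ P
    have hr : r ∈ Algebra.adjoin ℂ (Set.range R.x ∪ Set.range R.y ∪ Set.range R.w) :=
      R.adjoin_eq_top ▸ Algebra.mem_top
    replace hm : m ∈ P := hm
    induction hr using Algebra.adjoin_induction generalizing m with
    | mem r hr =>
      rcases hr with (⟨a, rfl⟩ | ⟨v, rfl⟩) | ⟨g, rfl⟩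
      · exact hx a m hm
      · exact hy v m hm
      · exact hw g m hm
    | algebraMap a => rw [algebraMap_smul]; exact P.smul_mem a hm
    | add r s _ _ h h' => rw [add_smul]; exact add_mem (h m hm) (h' m hm)
    | mul r s _ _ h h' => rw [mul_smul]; exact h _ (h' m hm)

/-- The action of `W` on an `H_c`-module. -/
def rep (M : Type) [AddCommGroup M] [Module ℂ M] [Module R.H M] [IsScalarTower ℂ R.H M] :
    Representation ℂ G.W M :=
  ((Algebra.lsmul ℂ ℂ M : R.H →ₐ[ℂ] Module.End ℂ M) : R.H →* Module.End ℂ M).comp R.w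

@[simp]
lemma rep_apply (g : G.W) (m : M) : R.rep M g m = R.w g • m := rfl

/-- The vectors killed by all `y v`. -/
def singular (M : Type) [AddCommGroup M] [Module ℂ M] [Module R.H M] [IsScalarTower ℂ R.H M] :
    Submodule ℂ M :=
  ⨅ v, LinearMap.ker (Algebra.lsmul ℂ ℂ M (R.y v))

variable {R}

lemma mem_singular {m : M} : m ∈ R.singular M ↔ ∀ v, R.y v • m = 0 := by
  simp [singular]

lemma w_smul_mem_singular (g : G.W) {m : M} (hm : m ∈ R.singular M) :
    R.w g • m ∈ R.singular M := by
  rw [mem_singular] at hm ⊢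
  intro v
  have h := R.w_y g ((g : V ≃ₗ[ℂ] V).symm v)
  rw [LinearEquiv.apply_symm_apply] at h
  rw [← mul_smul, ← h, mul_smul, hm, smul_zero]

variable (R) in
/-- The span of the products `x a₁ ⋯ x aₖ • u` with `u ∈ U`. -/
def layer (U : Submodule ℂ M) : ℕ → Submodule ℂ M
  | 0 => U
  | k + 1 => ⨆ a, (layer U k).map (Algebra.lsmul ℂ ℂ M (R.x a))

variable {U : Submodule ℂ M}

lemma x_smul_mem_layer (a : Module.Dual ℂ V) {k : ℕ} {m : M} (hm : m ∈ R.layer U k) :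
    R.x a • m ∈ R.layer U (k + 1) :=
  Submodule.mem_iSup_of_mem a ⟨m, hm, rfl⟩

lemma layer_succ_le {k : ℕ} {P : Submodule ℂ M}
    (h : ∀ a, ∀ m ∈ R.layer U k, R.x a • m ∈ P) : R.layer U (k + 1) ≤ P := by
  refine iSup_le fun a => ?_
  rintro _ ⟨m, hm, rfl⟩
  exact h a m hm

lemma w_smul_mem_layer (hU : ∀ g, ∀ u ∈ U, R.w g • u ∈ U) (g : G.W) (k : ℕ) :
    ∀ m ∈ R.layer U k, R.w g • m ∈ R.layer U k := by
  induction k with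
  | zero => exact hU g
  | succ k ih =>
    refine (layer_succ_le (P := (R.layer U (k + 1)).comap (Algebra.lsmul ℂ ℂ M (R.w g)))
      fun a m hm => ?_ : R.layer U (k + 1) ≤ _)
    change R.w g • R.x a • m ∈ R.layer U (k + 1)
    rw [← mul_smul, R.w_x, mul_smul]
    exact x_smul_mem_layer _ (ih m hm)

lemma y_smul_x_smul_mem (hU : ∀ g, ∀ u ∈ U, R.w g • u ∈ U) (v : V) (a : Module.Dual ℂ V)
    {k : ℕ} {m : M} (hm : m ∈ R.layer U k) (h : R.x a • R.y v • m ∈ R.layer U k) :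
    R.y v • R.x a • m ∈ R.layer U k := by
  have := Fintype.ofFinite G.Refl
  rw [← mul_smul, R.y_mul_x, sub_smul, add_smul, mul_smul, smul_assoc, one_smul,
    Finset.sum_smul]
  refine sub_mem (add_mem h (Submodule.smul_mem _ _ hm)) (sum_mem fun s _ => ?_)
  rw [smul_assoc]
  exact Submodule.smul_mem _ _ (w_smul_mem_layer hU _ k m hm)

lemma y_smul_mem_layer (hU : ∀ g, ∀ u ∈ U, R.w g • u ∈ U) (hs : U ≤ R.singular M) (v : V)
    (k : ℕ) : ∀ m ∈ R.layer U (k + 1), R.y v • m ∈ R.layer U k := by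
  induction k with
  | zero =>
    refine (layer_succ_le (P := (R.layer U 0).comap (Algebra.lsmul ℂ ℂ M (R.y v)))
      fun a m hm => y_smul_x_smul_mem hU v a hm ?_)
    rw [mem_singular.mp (hs hm), smul_zero]
    exact zero_mem _
  | succ k ih =>
    exact (layer_succ_le (P := (R.layer U (k + 1)).comap (Algebra.lsmul ℂ ℂ M (R.y v)))
      fun a m hm => y_smul_x_smul_mem hU v a hm (x_smul_mem_layer _ (ih m hm)))

lemma prod_y_smul_eq_zero (hU : ∀ g, ∀ u ∈ U, R.w g • u ∈ U) (hs : U ≤ R.singular M)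
    {k : ℕ} {m : M} (hm : m ∈ R.layer U k) (L : List V) (hL : k < L.length) :
    (L.map fun v => R.y v).prod • m = 0 := by
  induction L using List.reverseRecOn generalizing k m with
  | nil => simp at hL
  | append_singleton L v ih =>
    rw [List.map_append, List.prod_append, mul_smul, List.map_singleton, List.prod_singleton]
    cases k with
    | zero => rw [mem_singular.mp (hs hm), smul_zero]
    | succ k => exact ih (y_smul_mem_layer hU hs v k m hm) (by simpa using hL)

lemma span_le_iSup_layer (hU : ∀ g, ∀ u ∈ U, R.w g • u ∈ U) (hs : U ≤ R.singular M) :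
    ∀ m ∈ Submodule.span R.H (U : Set M), m ∈ ⨆ k, R.layer U k := by
  let Q : Submodule R.H M := R.submoduleOfStable (⨆ k, R.layer U k)
    (fun a => (iSup_le fun k m hm => Submodule.mem_iSup_of_mem (k + 1) (x_smul_mem_layer a hm) :
      _ ≤ (⨆ k, R.layer U k).comap (Algebra.lsmul ℂ ℂ M (R.x a))))
    (fun v => (iSup_le fun k m hm => by
        cases k with
        | zero =>
          have : R.y v • m = 0 := mem_singular.mp (hs hm) v
          simp [this]
        | succ k => exact Submodule.mem_iSup_of_mem k (y_smul_mem_layer hU hs v k m hm) :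
      _ ≤ (⨆ k, R.layer U k).comap (Algebra.lsmul ℂ ℂ M (R.y v))))
    (fun g => (iSup_le fun k m hm => Submodule.mem_iSup_of_mem k (w_smul_mem_layer hU g k m hm) :
      _ ≤ (⨆ k, R.layer U k).comap (Algebra.lsmul ℂ ℂ M (R.w g))))
  have h : Submodule.span R.H (U : Set M) ≤ Q :=
    Submodule.span_le.mpr fun u hu => Submodule.mem_iSup_of_mem (p := R.layer U) 0 hu
  exact h

lemma layer_le_span (k : ℕ) : ∀ m ∈ R.layer U k, m ∈ Submodule.span R.H (U : Set M) := by
  induction k with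
  | zero => exact fun m hm => Submodule.subset_span hm
  | succ k ih =>
    exact (layer_succ_le (P := (Submodule.span R.H (U : Set M)).restrictScalars ℂ)
      fun a m hm => Submodule.smul_mem _ _ (ih m hm))

lemma layer_le_eigenspace {n : ℕ} (b : Basis (Fin n) ℂ V) {μ : ℂ}
    (hU : ∀ u ∈ U, eulerElt R b • u = μ • u) (k : ℕ) :
    R.layer U k ≤ Module.End.eigenspace (Algebra.lsmul ℂ ℂ M (eulerElt R b)) (μ + k) := by
  induction k with
  | zero =>
    intro u hu
    rw [Module.End.mem_eigenspace_iff]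
    simpa using hU u hu
  | succ k ih =>
    refine layer_succ_le fun a m hm => ?_
    have h : eulerElt R b • m = (μ + k) • m := Module.End.mem_eigenspace_iff.mp (ih hm)
    rw [Module.End.mem_eigenspace_iff]
    change eulerElt R b • R.x a • m = _
    rw [← mul_smul, R.eulerElt_mul_x, add_smul, mul_smul, h, smul_comm, Nat.cast_succ,
      ← add_assoc, add_smul _ (1 : ℂ), one_smul]

/-- A nonzero module on which the `y v` act locally nilpotently has a nonzero singular vector. -/
lemma exists_singular_ne_zero
    (hN : ∀ m : M, ∃ N : ℕ, ∀ L : List V, L.length = N → (L.map fun v => R.y v).prod • m = 0)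
    (P : Submodule R.H M) (hP : P ≠ ⊥) : ∃ m ∈ P, m ∈ R.singular M ∧ m ≠ 0 := by
  classical
  obtain ⟨m, hm, hm0⟩ := Submodule.exists_mem_ne_zero_of_ne_bot hP
  have hk := Nat.find_spec (hN m)
  have hmin := fun j => Nat.find_min (hN m) (m := j)
  generalize Nat.find (hN m) = k at hk hmin
  cases k with
  | zero => exact absurd (by simpa using hk [] rfl) hm0
  | succ k =>
    have h := hmin k (Nat.lt_succ_self k)
    push Not at h
    obtain ⟨L, hL, hL0⟩ := h
    refine ⟨_, P.smul_mem _ hm, mem_singular.mpr fun v => ?_, hL0⟩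
    have := hk (v :: L) (by simp [hL])
    rwa [List.map_cons, List.prod_cons, mul_smul] at this

end RCA

section Verma

variable (R : RCA G D c) (τ : WRep G)

/-- The relations defining the Verma module as a quotient of the free module on `τ`. -/
def vermaRel : Set (τ.T →₀ R.H) :=
  (Set.range fun p : τ.T × τ.T =>
    Finsupp.single (p.1 + p.2) 1 - Finsupp.single p.1 1 - Finsupp.single p.2 1) ∪
  (Set.range fun p : ℂ × τ.T =>
    Finsupp.single (p.1 • p.2) 1 - Finsupp.single p.2 (algebraMap ℂ R.H p.1)) ∪
  (Set.range fun p : V × τ.T => Finsupp.single p.2 (R.y p.1)) ∪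
  (Set.range fun p : G.W × τ.T =>
    Finsupp.single p.2 (R.w p.1) - Finsupp.single (τ.ρ p.1 p.2) 1)

/-- The Verma module by generators and relations. -/
abbrev Verma : Type := (τ.T →₀ R.H) ⧸ Submodule.span R.H (vermaRel R τ)

/-- The class of a generator in the Verma module. -/
def vermaGen (t : τ.T) : Verma R τ := Submodule.Quotient.mk (Finsupp.single t 1)

lemma smul_vermaGen (r : R.H) (t : τ.T) :
    r • vermaGen R τ t = Submodule.Quotient.mk (Finsupp.single t r) := by
  rw [vermaGen, ← Submodule.Quotient.mk_smul, Finsupp.smul_single, smul_eq_mul, mul_one]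

lemma vermaGen_add (t t' : τ.T) :
    vermaGen R τ (t + t') = vermaGen R τ t + vermaGen R τ t' := by
  rw [vermaGen, vermaGen, vermaGen, ← Submodule.Quotient.mk_add, Submodule.Quotient.eq, ← sub_sub]
  exact Submodule.subset_span (Or.inl (Or.inl (Or.inl ⟨(t, t'), rfl⟩)))

lemma vermaGen_smul (a : ℂ) (t : τ.T) :
    vermaGen R τ (a • t) = algebraMap ℂ R.H a • vermaGen R τ t := by
  rw [smul_vermaGen, vermaGen, Submodule.Quotient.eq]
  exact Submodule.subset_span (Or.inl (Or.inl (Or.inr ⟨(a, t), rfl⟩)))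

lemma y_smul_vermaGen (v : V) (t : τ.T) : R.y v • vermaGen R τ t = 0 := by
  rw [smul_vermaGen, Submodule.Quotient.mk_eq_zero]
  exact Submodule.subset_span (Or.inl (Or.inr ⟨(v, t), rfl⟩))

lemma w_smul_vermaGen (g : G.W) (t : τ.T) :
    R.w g • vermaGen R τ t = vermaGen R τ (τ.ρ g t) := by
  rw [smul_vermaGen, vermaGen, Submodule.Quotient.eq]
  exact Submodule.subset_span (Or.inr ⟨(g, t), rfl⟩)

lemma span_range_vermaGen : Submodule.span R.H (Set.range (vermaGen R τ)) = ⊤ := by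
  refine eq_top_iff.mpr fun m _ => ?_
  obtain ⟨f, rfl⟩ := Submodule.Quotient.mk_surjective _ m
  induction f using Finsupp.induction_linear with
  | zero => exact zero_mem _
  | add f g hf hg => rw [Submodule.Quotient.mk_add]; exact add_mem (hf trivial) (hg trivial)
  | single t r =>
    rw [← smul_vermaGen]
    exact Submodule.smul_mem _ _ (Submodule.subset_span ⟨t, rfl⟩)

/-- The inclusion of the lowest weight space, as a `ℂ`-linear map. -/
def vermaGenLinear : τ.T →ₗ[ℂ] Verma R τ where
  toFun := vermaGen R τ
  map_add' := vermaGen_add R τ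
  map_smul' a t := by rw [vermaGen_smul, algebraMap_smul, RingHom.id_apply]

/-- The universal property of the Verma module. -/
def vermaStr : VermaStr R τ (Verma R τ) where
  ι := (vermaGenLinear R τ).toAddMonoidHom
  ι_smul := vermaGen_smul R τ
  ι_y := y_smul_vermaGen R τ
  ι_w := w_smul_vermaGen R τ
  universal N _ _ κ h1 h2 h3 := by
    have hle : Submodule.span R.H (vermaRel R τ) ≤
        LinearMap.ker (Finsupp.linearCombination R.H κ) := by
      refine Submodule.span_le.mpr ?_
      rintro _ (((⟨p, rfl⟩ | ⟨p, rfl⟩) | ⟨p, rfl⟩) | ⟨p, rfl⟩) <;>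
        simp [h1, h2, h3]
    have hgen : ∀ t, Submodule.liftQ _ _ hle (vermaGen R τ t) = κ t := fun t => by
      rw [vermaGen, Submodule.liftQ_apply, Finsupp.linearCombination_single, one_smul]
    refine ⟨Submodule.liftQ _ _ hle, hgen, fun ψ hψ => ?_⟩
    refine LinearMap.ext_on (span_range_vermaGen R τ) ?_
    rintro _ ⟨t, rfl⟩
    exact (hψ t).trans (hgen t).symm

/-- The Verma module as an object of category `𝒪`. -/
def vermaO : CatO R where
  M := Verma R τ
  locNilp m := by
    set U := LinearMap.range (vermaGenLinear R τ)
    have hw : ∀ g, ∀ u ∈ U, R.w g • u ∈ U := by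
      rintro g _ ⟨t, rfl⟩
      exact ⟨τ.ρ g t, (w_smul_vermaGen R τ g t).symm⟩
    have hs : U ≤ R.singular (Verma R τ) := by
      rintro _ ⟨t, rfl⟩
      exact RCA.mem_singular.mpr fun v => y_smul_vermaGen R τ v t
    have hm : m ∈ ⨆ k, R.layer U k := by
      refine RCA.span_le_iSup_layer hw hs m ?_
      have : (U : Set (Verma R τ)) = Set.range (vermaGen R τ) := rfl
      rw [this, span_range_vermaGen]
      exact Submodule.mem_top
    suffices h : ∃ N : ℕ, ∀ L : List V, N ≤ L.length → (L.map fun v => R.y v).prod • m = 0 from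
      h.imp fun N hN L hL => hN L hL.ge
    induction hm using Submodule.iSup_induction' with
    | mem k m hm => exact ⟨k + 1, fun L hL => RCA.prod_y_smul_eq_zero hw hs hm L hL⟩
    | zero => exact ⟨0, fun L _ => smul_zero _⟩
    | add m m' _ _ h h' =>
      obtain ⟨N, hN⟩ := h
      obtain ⟨N', hN'⟩ := h'
      refine ⟨max N N', fun L hL => ?_⟩
      rw [smul_add, hN L (le_of_max_le_left hL), hN' L (le_of_max_le_right hL), add_zero]
  fg := by
    let e := Module.finBasis ℂ τ.T
    refine ⟨Submodule.fg_def.mpr ⟨Set.range fun i => vermaGen R τ (e i), Set.finite_range _, ?_⟩⟩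
    rw [eq_top_iff, ← span_range_vermaGen, Submodule.span_le]
    rintro _ ⟨t, rfl⟩
    change vermaGenLinear R τ t ∈ _
    rw [← e.sum_repr t, map_sum]
    refine sum_mem fun i _ => ?_
    rw [map_smul, ← algebraMap_smul R.H]
    exact Submodule.smul_mem _ _ (Submodule.subset_span ⟨i, rfl⟩)

end Verma

namespace RCA

variable {R : RCA G D c} {M : Type} [AddCommGroup M] [Module ℂ M] [Module R.H M]
  [IsScalarTower ℂ R.H M] {U : Submodule ℂ M}

/-- An irreducible subspace as a representation of `W`. -/
def subRep (hU : IsIrredSub (R.rep M) U) : WRep G where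
  T := U
  fd := hU.finiteDimensional
  ρ :=
    { toFun := fun g => LinearEquiv.ofLinearMap ((R.rep M g).restrict (hU.map_mem g))
        ((R.rep M g⁻¹).restrict (hU.map_mem g⁻¹))
        (by ext u; simp [← mul_smul, ← map_mul]) (by ext u; simp [← mul_smul, ← map_mul])
      map_one' := by ext u; simp
      map_mul' := fun g h => by ext u; simp }

lemma subRep_isIrr (hU : IsIrredSub (R.rep M) U) : (subRep hU).IsIrr := by
  refine ⟨Submodule.nontrivial_iff_ne_bot.mpr hU.ne_bot, fun Y hY => ?_⟩
  change Submodule ℂ U at Y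
  by_cases h : Y = ⊥
  · exact Or.inl h
  · refine Or.inr ?_
    have h1 : Y.map U.subtype = U := by
      refine hU.eq_of_le _ (Submodule.map_subtype_le _ _)
        (fun h0 => h (Submodule.map_injective_of_injective U.injective_subtype
          (h0.trans (Submodule.map_bot _).symm))) ?_
      rintro g _ ⟨u, hu, rfl⟩
      exact ⟨_, hY g u hu, rfl⟩
    exact Submodule.map_injective_of_injective U.injective_subtype
      (h1.trans (Submodule.map_subtype_top U).symm)

variable {n : ℕ} {b : Basis (Fin n) ℂ V} {cF : WRep G → ℂ}

/-- The Euler element acts on irreducible spaces of singular vectors as on lowest weight spaces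
of Verma modules. -/
lemma eulerElt_smul
    (hcF : ∀ (τ : WRep G), τ.IsIrr → ∀ (Δ : CatO R) (vs : VermaStr R τ Δ.M)
      (t : τ.T), eulerElt R b • vs.ι t = algebraMap ℂ R.H (cF τ) • vs.ι t)
    (hU : IsIrredSub (R.rep M) U) (hs : U ≤ R.singular M) (u : M) (hu : u ∈ U) :
    eulerElt R b • u = cF (subRep hU) • u := by
  obtain ⟨φ, hφ, -⟩ := (vermaStr R (subRep hU)).universal M U.subtype.toAddMonoidHom
    (fun a t => (algebraMap_smul R.H a (U.subtype t)).symm)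
    (fun v t => mem_singular.mp (hs t.2) v) (fun g t => rfl)
  have h := congrArg φ (hcF (subRep hU) (subRep_isIrr hU) (vermaO R (subRep hU))
    (vermaStr R (subRep hU)) ⟨u, hu⟩)
  have h' := hφ ⟨u, hu⟩
  erw [map_smul, map_smul, h', algebraMap_smul] at h
  exact h

/-- A nonzero submodule of a locally nilpotent module contains an irreducible space of singular
vectors. -/
lemma exists_isIrredSub_le
    (hN : ∀ m : M, ∃ N : ℕ, ∀ L : List V, L.length = N → (L.map fun v => R.y v).prod • m = 0)
    (P : Submodule R.H M) (hP : P ≠ ⊥) :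
    ∃ U : Submodule ℂ M, IsIrredSub (R.rep M) U ∧ U ≤ R.singular M ∧ ∀ u ∈ U, u ∈ P := by
  obtain ⟨m, hmP, hms, hm0⟩ := exists_singular_ne_zero hN P hP
  have h := le_sSup_isIrredSub (ρ := R.rep M) (S := P.restrictScalars ℂ ⊓ R.singular M)
    fun g u hu => ⟨P.smul_mem _ hu.1, w_smul_mem_singular g hu.2⟩
  by_contra! hno
  refine hm0 ((Submodule.mem_bot ℂ).mp ?_)
  have hbot : sSup {U | U ≤ P.restrictScalars ℂ ⊓ R.singular M ∧ IsIrredSub (R.rep M) U} ≤ ⊥ := by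
    refine sSup_le fun U hU => ?_
    obtain ⟨u, hu, huP⟩ := hno U hU.2 (hU.1.trans inf_le_right)
    exact absurd (hU.1 hu).1 huP
  exact hbot (h ⟨hmP, hms⟩)

lemma isSimpleModule_span
    (hN : ∀ m : M, ∃ N : ℕ, ∀ L : List V, L.length = N → (L.map fun v => R.y v).prod • m = 0)
    (hcF : ∀ (τ : WRep G), τ.IsIrr → ∀ (Δ : CatO R) (vs : VermaStr R τ Δ.M)
      (t : τ.T), eulerElt R b • vs.ι t = algebraMap ℂ R.H (cF τ) • vs.ι t)
    (hsep : ∀ ξ τ : WRep G, ξ.IsIrr → τ.IsIrr → ∀ m : ℤ, m ≠ 0 → cF ξ - cF τ ≠ (m : ℂ))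
    (hU : IsIrredSub (R.rep M) U) (hs : U ≤ R.singular M) :
    IsSimpleModule R.H (Submodule.span R.H (U : Set M)) := by
  rw [isSimpleModule_iff_isAtom]
  refine ⟨fun h0 => hU.ne_bot ?_, fun P hP => ?_⟩
  · refine (Submodule.eq_bot_iff _).mpr fun u hu => ?_
    exact (Submodule.eq_bot_iff _).mp h0 u (Submodule.subset_span hu)
  · by_contra hP0
    obtain ⟨U', hU', hs', hUP⟩ := exists_isIrredSub_le hN P hP0
    have hle : U' ≤ U := by
      intro u hu
      have h := mem_iSup_of_eigenvector (layer_le_eigenspace b (eulerElt_smul hcF hU hs))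
        (span_le_iSup_layer hU.map_mem hs u (hP.le (hUP u hu)))
        (eulerElt_smul hcF hU' hs' u hu)
      refine (iSup₂_le fun k hk => ?_ :
        ⨆ k : ℕ, ⨆ _ : cF (subRep hU) + k = cF (subRep hU'), R.layer U k ≤ U) h
      cases k with
      | zero => exact le_rfl
      | succ k =>
        refine absurd ?_ (hsep _ _ (subRep_isIrr hU') (subRep_isIrr hU) (k + 1) (by omega))
        rw [← hk]
        push_cast
        ring
    have heq := hU.eq_of_le U' hle hU'.ne_bot hU'.map_mem
    exact hP.not_ge (Submodule.span_le.mpr fun u hu => hUP u (heq ▸ hu))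

lemma iSup_span_eq_top
    (hN : ∀ m : M, ∃ N : ℕ, ∀ L : List V, L.length = N → (L.map fun v => R.y v).prod • m = 0)
    (hcF : ∀ (τ : WRep G), τ.IsIrr → ∀ (Δ : CatO R) (vs : VermaStr R τ Δ.M)
      (t : τ.T), eulerElt R b • vs.ι t = algebraMap ℂ R.H (cF τ) • vs.ι t)
    (hsep : ∀ ξ τ : WRep G, ξ.IsIrr → τ.IsIrr → ∀ m : ℤ, m ≠ 0 → cF ξ - cF τ ≠ (m : ℂ)) :
    ⨆ U : {U : Submodule ℂ M // U ≤ R.singular M ∧ IsIrredSub (R.rep M) U},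
      Submodule.span R.H (U.1 : Set M) = ⊤ := by
  set I := {U : Submodule ℂ M // U ≤ R.singular M ∧ IsIrredSub (R.rep M) U}
  set P := ⨆ U : I, Submodule.span R.H (U.1 : Set M)
  set T : Module.End ℂ M := Algebra.lsmul ℂ ℂ M (eulerElt R b)
  have hTa : ∀ m, T m = eulerElt R b • m := fun m => rfl
  let F : I × ℕ → Submodule ℂ M := fun i => R.layer i.1.1 i.2
  let χ : I × ℕ → ℂ := fun i => cF (subRep i.1.2.2) + i.2
  have hF : ∀ i, F i ≤ T.eigenspace (χ i) := fun i =>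
    layer_le_eigenspace b (eulerElt_smul hcF i.1.2.2 i.1.2.1) i.2
  have hPF : ∀ m ∈ P, m ∈ ⨆ i, F i := by
    intro m hm
    induction hm using Submodule.iSup_induction' with
    | mem U m hm =>
      refine (iSup_le fun k => le_iSup F (U, k) : ⨆ k, R.layer U.1 k ≤ ⨆ i, F i) ?_
      exact span_le_iSup_layer U.2.2.map_mem U.2.1 m hm
    | zero => exact zero_mem _
    | add m m' _ _ h h' => exact add_mem h h'
  have hFP : ⨆ i, F i ≤ P.restrictScalars ℂ := iSup_le fun i m hm =>
    Submodule.mem_iSup_of_mem i.1 (layer_le_span i.2 m hm)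
  have hsP : R.singular M ≤ P.restrictScalars ℂ :=
    (le_sSup_isIrredSub (ρ := R.rep M) fun g u hu => w_smul_mem_singular g hu).trans
      (sSup_le fun U hU u hu => Submodule.mem_iSup_of_mem
        (p := fun U : I => Submodule.span R.H (U.1 : Set M)) ⟨U, hU⟩ (Submodule.subset_span hu))
  by_contra hne
  have : Nontrivial (M ⧸ P) := Submodule.Quotient.nontrivial_iff.mpr hne
  obtain ⟨U, hU, hs, -⟩ := exists_isIrredSub_le (R := R) (M := M ⧸ P) (fun q => by
    obtain ⟨m, rfl⟩ := Submodule.Quotient.mk_surjective _ q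
    refine (hN m).imp fun N h L hL => ?_
    rw [← Submodule.Quotient.mk_smul, h L hL, Submodule.Quotient.mk_zero]) ⊤ top_ne_bot
  obtain ⟨q, hq, hq0⟩ := Submodule.exists_mem_ne_zero_of_ne_bot hU.ne_bot
  obtain ⟨m, rfl⟩ := Submodule.Quotient.mk_surjective _ q
  have hE := eulerElt_smul hcF hU hs _ hq
  set μ := cF (subRep hU)
  rw [← Submodule.Quotient.mk_smul, ← Submodule.Quotient.mk_smul, Submodule.Quotient.eq] at hE
  obtain ⟨v, hv, hv'⟩ := exists_sub_mem_eigenspace hF μ (hPF _ hE)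
  have hvP : v ∈ P := hFP hv
  have hz := Module.End.mem_eigenspace_iff.mp (neg_mem hv')
  have hz' : -(T v - μ • v - (eulerElt R b • m - μ • m)) = T (m - v) - μ • (m - v) := by
    rw [map_sub, smul_sub, hTa m]
    abel
  rw [hz'] at hz
  have hyT : ∀ (w : V) (p : M), T (R.y w • p) = R.y w • T p - R.y w • p := fun w p => by
    rw [hTa, hTa, ← mul_smul, R.eulerElt_mul_y, sub_smul, mul_smul]
  have hsing : m - v ∈ R.singular M := by
    refine mem_singular.mpr fun w => ?_
    have hyP : R.y w • (m - v) ∈ P := by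
      rw [smul_sub]
      refine sub_mem ((Submodule.Quotient.mk_eq_zero _).mp ?_) (P.smul_mem _ hvP)
      rw [Submodule.Quotient.mk_smul]
      exact mem_singular.mp (hs hq) w
    refine eq_zero_of_generalized_eigenvector hF (μ := μ - 1) (fun i hi => ?_) (hPF _ hyP) ?_
    · refine hsep _ _ (subRep_isIrr hU) (subRep_isIrr i.1.2.2) (i.2 + 1) (by omega) ?_
      push_cast
      linear_combination -hi
    · have h1 : T (R.y w • (m - v)) - (μ - 1) • R.y w • (m - v) =
          R.y w • (T (m - v) - μ • (m - v)) := by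
        rw [hyT, smul_sub (R.y w) (T (m - v)), smul_comm (R.y w) μ, sub_smul, one_smul]
        abel
      rw [h1, hyT, hz, smul_comm (R.y w) μ, sub_smul, one_smul]
  refine hq0 ((Submodule.Quotient.mk_eq_zero _).mpr ?_)
  have := add_mem (hsP hsing) hvP
  rwa [sub_add_cancel] at this

end RCA

/-- **Generic semisimplicity of category 𝒪.**
Let `c_τ` be the scalar by which the Euler element acts on the lowest weight
space `τ ⊂ Δ_c(τ)`.  If `c_ξ − c_τ ∉ ℤ \ {0}` for all irreducible `ξ, τ`,
then `𝒪_c(W)` is semisimple. -/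
theorem catO_semisimple_of_no_integral_differences
    (hc : IsConjInvariant c) (R : RCA G D c)
    {n : ℕ} (b : Basis (Fin n) ℂ V)
    -- `cF τ` is the scalar by which the Euler element acts on `τ ⊂ Δ_c(τ)`
    (cF : WRep G → ℂ)
    (hcF : ∀ (τ : WRep G), τ.IsIrr → ∀ (Δ : CatO R) (vs : VermaStr R τ Δ.M)
      (t : τ.T), eulerElt R b • vs.ι t = algebraMap ℂ R.H (cF τ) • vs.ι t)
    -- the separation condition: c_ξ − c_τ is never a nonzero integer
    (hsep : ∀ ξ τ : WRep G, ξ.IsIrr → τ.IsIrr →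
      ∀ m : ℤ, m ≠ 0 → cF ξ - cF τ ≠ (m : ℂ)) :
    ∀ A : CatO R, IsSemisimpleModule R.H A.M := by
  intro A
  let _ : Module ℂ A.M := Module.compHom A.M (algebraMap ℂ R.H)
  have : IsScalarTower ℂ R.H A.M := IsScalarTower.of_algebraMap_smul fun _ _ => rfl
  refine isSemisimpleModule_of_isSemisimpleModule_submodule' (fun U => ?_)
    (RCA.iSup_span_eq_top A.locNilp hcF hsep)
  have := RCA.isSimpleModule_span A.locNilp hcF hsep U.2.2 U.2.1
  infer_instance

end
end Stmt6
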